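/- Consider the multi-agent system of N clusters with the dynamic coupling law, gains K_i = −B_iᵀP_i with P_i symmetric positive definite solving P_iA_i + A_iᵀP_i − P_iB_iB_iᵀP_i = −I, and every block L_{ij} of the graph Laplacian having zero row sums. Assume: each subgraph G_i has only cooperative edges (a_{lk} ≥ 0 for l,k ∈ C_i) and contains a directed spanning tree (there exists r ∈ C_i from which every l ∈ C_i is reachable along edges within C_i with a_{lk} > 0); the global factor satisfies c > max_i λ_max(A_i + A_iᵀ); and for symmetric positive definite matrices Ŵ_i with Ŵ_i L̂_{ii} + L̂_{ii}ᵀ Ŵ_i positive definite and Ŵ = blockdiag{Ŵ_1,…,Ŵ_N}, each local factor satisfies c_i ≥ (λ_max(Ŵ) − λ_min(Ŵ L̂_o + L̂_oᵀ Ŵ)) / λ_min(Ŵ_i L̂_{ii} + L̂_{ii}ᵀ Ŵ_i), where L̂_o = L̂_c − blockdiag{c_1 L̂_{11},…,c_N L̂_{NN}}. Then the matrix Â − c L̂_c ⊗ I_n is Hurwitz, every solution of ζ̇ = (Â − c L̂_c ⊗ I_n)ζ decays exponentially with rate at least ½(c − λ_max(Â + Âᵀ)), and consequently for all initial conditions the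 closed-loop solutions satisfy x_l(t) − x_k(t) → 0 for l,k in the same cluster and η_l(t) → 0 for all l. -/

import Mathlib

open Matrix Filter Topology

/-- A real square matrix is Hurwitz if every complex eigenvalue has negative real part. -/
noncomputable def IsHurwitz {m : Type*} [Fintype m] [DecidableEq m] (M : Matrix m m ℝ) : Prop :=
  ∀ μ ∈ spectrum ℂ (M.map Complex.ofReal), μ.re < 0

/-- Largest real eigenvalue (for symmetric matrices, `λ_max`). -/
noncomputable def maxEig {m : Type*} [Fintype m] [DecidableEq m]
    (M : Matrix m m ℝ) : ℝ :=
  sSup (spectrum ℝ M)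

/-- Smallest real eigenvalue (for symmetric matrices, `λ_min`). -/
noncomputable def minEig {m : Type*} [Fintype m] [DecidableEq m]
    (M : Matrix m m ℝ) : ℝ :=
  sInf (spectrum ℝ M)

/-- The reduced matrix `L̂` of a block-partitioned matrix `b` on the index set
`Σ i, Fin (l i)`. -/
noncomputable def reducedLap (N : ℕ) (l : Fin N → ℕ)
    (b : ((i : Fin N) × Fin (l i)) → ((i : Fin N) × Fin (l i)) → ℝ) :
    Matrix ((i : Fin N) × Fin (l i - 1)) ((i : Fin N) × Fin (l i - 1)) ℝ :=
  Matrix.of fun p q =>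
    b ⟨p.1, ⟨p.2.1 + 1, by have := p.2.2; omega⟩⟩ ⟨q.1, ⟨q.2.1 + 1, by have := q.2.2; omega⟩⟩
      - b ⟨p.1, ⟨0, by have := p.2.2; omega⟩⟩ ⟨q.1, ⟨q.2.1 + 1, by have := q.2.2; omega⟩⟩

/-- The weighted reduced matrix `L̂_c`: diagonal blocks `c_i L̂_{ii}`, off-diagonal
blocks `L̂_{ij}`. -/
noncomputable def reducedLapWeighted (N : ℕ) (l : Fin N → ℕ) (ci : Fin N → ℝ)
    (b : ((i : Fin N) × Fin (l i)) → ((i : Fin N) × Fin (l i)) → ℝ) :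
    Matrix ((i : Fin N) × Fin (l i - 1)) ((i : Fin N) × Fin (l i - 1)) ℝ :=
  Matrix.of fun p q =>
    (if p.1 = q.1 then ci p.1 else 1) * reducedLap N l b p q

/-- The off-block-diagonal part `L̂_o = L̂_c - blockdiag{c_1 L̂_{11}, …, c_N L̂_{NN}}`. -/
noncomputable def reducedLapOff (N : ℕ) (l : Fin N → ℕ)
    (b : ((i : Fin N) × Fin (l i)) → ((i : Fin N) × Fin (l i)) → ℝ) :
    Matrix ((i : Fin N) × Fin (l i - 1)) ((i : Fin N) × Fin (l i - 1)) ℝ :=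
  Matrix.of fun p q => if p.1 = q.1 then 0 else reducedLap N l b p q

/-- The `(i,i)` diagonal block of a matrix on `Σ i, Fin (l i - 1)`. -/
noncomputable def diagBlock {N : ℕ} {l : Fin N → ℕ}
    (M : Matrix ((i : Fin N) × Fin (l i - 1)) ((i : Fin N) × Fin (l i - 1)) ℝ)
    (i : Fin N) : Matrix (Fin (l i - 1)) (Fin (l i - 1)) ℝ :=
  Matrix.of fun p q => M ⟨i, p⟩ ⟨i, q⟩

/-- `Â = blockdiag {I_{l_1 - 1} ⊗ A_1, …, I_{l_N - 1} ⊗ A_N}`. -/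
noncomputable def hatA (n N : ℕ) (l : Fin N → ℕ) (A : Fin N → Matrix (Fin n) (Fin n) ℝ) :
    Matrix (((i : Fin N) × Fin (l i - 1)) × Fin n)
      (((i : Fin N) × Fin (l i - 1)) × Fin n) ℝ :=
  Matrix.of fun p q => if p.1 = q.1 then A p.1.1 p.2 q.2 else 0

/-- The matrix `Â - c L̂_c ⊗ I_n`. -/
noncomputable def clusterMatrix (n N : ℕ) (l : Fin N → ℕ) (c : ℝ) (ci : Fin N → ℝ)
    (A : Fin N → Matrix (Fin n) (Fin n) ℝ)
    (b : ((i : Fin N) × Fin (l i)) → ((i : Fin N) × Fin (l i)) → ℝ) :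
    Matrix (((i : Fin N) × Fin (l i - 1)) × Fin n)
      (((i : Fin N) × Fin (l i - 1)) × Fin n) ℝ :=
  hatA n N l A -
    c • Matrix.kroneckerMap (· * ·) (reducedLapWeighted N l ci b)
      (1 : Matrix (Fin n) (Fin n) ℝ)

section QuadraticForms

variable {ι : Type*} [Fintype ι]

lemma sq_norm_le_dotProduct (x : ι → ℝ) : ‖x‖ ^ 2 ≤ x ⬝ᵥ x := by
  have h0 : 0 ≤ x ⬝ᵥ x := by simpa using dotProduct_star_self_nonneg x
  have : ‖x‖ ≤ √(x ⬝ᵥ x) := by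
    rw [pi_norm_le_iff_of_nonneg (Real.sqrt_nonneg _)]
    intro i
    refine Real.abs_le_sqrt ?_
    rw [sq]
    exact Finset.single_le_sum (f := fun j => x j * x j) (fun j _ => mul_self_nonneg _)
      (Finset.mem_univ i)
  calc ‖x‖ ^ 2 ≤ √(x ⬝ᵥ x) ^ 2 := by gcongr
    _ = _ := Real.sq_sqrt h0

variable [DecidableEq ι]

lemma posSemidef_maxEig_sub {M : Matrix ι ι ℝ} (hM : M.IsHermitian) :
    (maxEig M • (1 : Matrix ι ι ℝ) - M).PosSemidef := by
  have hH : (maxEig M • (1 : Matrix ι ι ℝ) - M).IsHermitian := by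
    refine IsHermitian.sub ?_ hM
    simp [IsHermitian]
  rw [posSemidef_iff_isHermitian_and_spectrum_nonneg]
  refine ⟨hH, fun μ hμ => ?_⟩
  have h : maxEig M - μ ∈ spectrum ℝ M := by
    rw [spectrum.mem_iff] at hμ ⊢
    rw [← IsUnit.neg_iff]
    convert hμ using 2
    simp only [Algebra.algebraMap_eq_smul_one, sub_smul]
    abel
  have := le_csSup (finite_real_spectrum (A := M)).bddAbove h
  rw [← maxEig] at this
  simpa using this

lemma posSemidef_sub_minEig {M : Matrix ι ι ℝ} (hM : M.IsHermitian) :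
    (M - minEig M • (1 : Matrix ι ι ℝ)).PosSemidef := by
  have hH : (M - minEig M • (1 : Matrix ι ι ℝ)).IsHermitian := by
    refine IsHermitian.sub hM ?_
    simp [IsHermitian]
  rw [posSemidef_iff_isHermitian_and_spectrum_nonneg]
  refine ⟨hH, fun μ hμ => ?_⟩
  have h : minEig M + μ ∈ spectrum ℝ M := by
    rw [spectrum.mem_iff] at hμ ⊢
    convert hμ using 2
    simp only [Algebra.algebraMap_eq_smul_one, add_smul]
    abel
  have := csInf_le (finite_real_spectrum (A := M)).bddBelow h
  rw [← minEig] at this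
  simpa using this

lemma minEig_pos [Nonempty ι] {M : Matrix ι ι ℝ} (hM : M.PosDef) : 0 < minEig M := by
  have hne : (spectrum ℝ M).Nonempty :=
    ⟨_, hM.1.eigenvalues_mem_spectrum_real (Classical.arbitrary ι)⟩
  have h := hne.csInf_mem (finite_real_spectrum (A := M))
  rw [← minEig, hM.1.spectrum_real_eq_range_eigenvalues] at h
  obtain ⟨i, hi⟩ := h
  rw [← hi]
  exact hM.eigenvalues_pos i

lemma maxEig_lt [Nonempty ι] {M : Matrix ι ι ℝ} (hM : M.IsHermitian) {c : ℝ}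
    (h : ∀ x : ι → ℝ, x ≠ 0 → x ⬝ᵥ M *ᵥ x < c * (x ⬝ᵥ x)) : maxEig M < c := by
  have hne : (spectrum ℝ M).Nonempty :=
    ⟨_, hM.eigenvalues_mem_spectrum_real (Classical.arbitrary ι)⟩
  have hmem := hne.csSup_mem (finite_real_spectrum (A := M))
  rw [← maxEig, ← Matrix.spectrum_toLin', ← Module.End.hasEigenvalue_iff_mem_spectrum] at hmem
  obtain ⟨v, hv⟩ := hmem.exists_hasEigenvector
  have h1 := h v hv.2
  have h2 : M *ᵥ v = maxEig M • v := by simpa using hv.apply_eq_smul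
  rw [h2, dotProduct_smul, smul_eq_mul] at h1
  have h3 : 0 < v ⬝ᵥ v := by simpa using (dotProduct_star_self_pos_iff (v := v)).2 hv.2
  exact lt_of_mul_lt_mul_right h1 h3.le

open scoped MatrixOrder in
lemma Matrix.PosSemidef.mul_of_commute {M S : Matrix ι ι ℝ} (hM : M.PosSemidef)
    (hS : S.PosSemidef) (h : Commute M S) : (M * S).PosSemidef := by
  rw [← nonneg_iff_posSemidef] at *
  exact h.mul_nonneg hM hS

lemma exists_pos_mul_dotProduct_le {M : Matrix ι ι ℝ} (hM : M.PosDef) :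
    ∃ δ > 0, ∀ x : ι → ℝ, δ * (x ⬝ᵥ x) ≤ x ⬝ᵥ M *ᵥ x := by
  rcases isEmpty_or_nonempty ι with h | h
  · exact ⟨1, one_pos, fun x => by simp [dotProduct]⟩
  · refine ⟨minEig M, minEig_pos hM, fun x => ?_⟩
    have := (posSemidef_sub_minEig hM.1).dotProduct_mulVec_nonneg x
    simpa [sub_mulVec, smul_mulVec] using this

variable {o : Type*} [Fintype o] [DecidableEq o] {m' : o → Type*} [∀ i, Fintype (m' i)]
  {M : ∀ i, Matrix (m' i) (m' i) ℝ}

lemma dotProduct_blockDiagonal'_mulVec (M : ∀ i, Matrix (m' i) (m' i) ℝ)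
    (x : (i : o) × m' i → ℝ) :
    x ⬝ᵥ blockDiagonal' M *ᵥ x = ∑ i, (fun p => x ⟨i, p⟩) ⬝ᵥ M i *ᵥ (fun p => x ⟨i, p⟩) := by
  simp only [dotProduct, mulVec, Fintype.sum_sigma]
  refine Finset.sum_congr rfl fun i _ => Finset.sum_congr rfl fun p _ => ?_
  rw [Finset.sum_eq_single i]
  · simp [blockDiagonal'_apply_eq]
  · intro j _ hj
    simp [blockDiagonal'_apply_ne _ _ _ hj.symm]
  · simp

lemma posSemidef_blockDiagonal' (h : ∀ i, (M i).PosSemidef) :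
    (blockDiagonal' M).PosSemidef := by
  refine .of_dotProduct_mulVec_nonneg
    (isHermitian_blockDiagonal'_iff.2 fun i => (h i).1) fun x => ?_
  rw [star_trivial, dotProduct_blockDiagonal'_mulVec]
  exact Finset.sum_nonneg fun i _ => by simpa using (h i).dotProduct_mulVec_nonneg _

lemma posDef_blockDiagonal' (h : ∀ i, (M i).PosDef) : (blockDiagonal' M).PosDef := by
  refine .of_dotProduct_mulVec_pos
    (isHermitian_blockDiagonal'_iff.2 fun i => (h i).1) fun x hx => ?_
  rw [star_trivial, dotProduct_blockDiagonal'_mulVec]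
  obtain ⟨⟨i, p⟩, hp⟩ := Function.ne_iff.1 hx
  refine Finset.sum_pos'
    (fun j _ => by simpa using (h j).posSemidef.dotProduct_mulVec_nonneg _)
    ⟨i, Finset.mem_univ i, ?_⟩
  have hne : (fun p => x ⟨i, p⟩) ≠ 0 := fun h0 => hp (congrFun h0 p)
  simpa using (h i).dotProduct_mulVec_pos hne

end QuadraticForms

section Lyapunov

lemma le_of_hasDerivAt_le_neg_mul {V V' : ℝ → ℝ} {κ ε T : ℝ}
    (hV : ∀ t, HasDerivAt V (V' t) t) (h : ∀ t, T ≤ t → V' t ≤ -κ * (V t - ε)) {t : ℝ}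
    (ht : T ≤ t) : V t ≤ ε + (V T - ε) * Real.exp (-κ * (t - T)) := by
  have hd : ∀ s, HasDerivAt (fun s => (V s - ε) * Real.exp (κ * (s - T)))
      ((V' s + κ * (V s - ε)) * Real.exp (κ * (s - T))) s := by
    intro s
    have h1 : HasDerivAt (fun s => Real.exp (κ * (s - T))) (Real.exp (κ * (s - T)) * (κ * 1)) s :=
      (((hasDerivAt_id s).sub_const T).const_mul κ).exp
    refine (((hV s).sub_const ε).mul h1).congr_deriv ?_
    ring
  have hanti : AntitoneOn (fun s => (V s - ε) * Real.exp (κ * (s - T))) (Set.Ici T) := by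
    refine antitoneOn_of_deriv_nonpos (convex_Ici T)
      (fun s _ => (hd s).continuousAt.continuousWithinAt)
      (fun s _ => (hd s).differentiableAt.differentiableWithinAt) fun s hs => ?_
    rw [interior_Ici, Set.mem_Ioi] at hs
    rw [(hd s).deriv]
    exact mul_nonpos_of_nonpos_of_nonneg (by linarith [h s hs.le]) (Real.exp_pos _).le
  have h2 : (V t - ε) * Real.exp (κ * (t - T)) ≤ V T - ε := by
    simpa using hanti (Set.self_mem_Ici) ht ht
  have h3 := mul_le_mul_of_nonneg_right h2 (Real.exp_pos (-κ * (t - T))).le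
  rw [mul_assoc, ← Real.exp_add] at h3
  have h4 : κ * (t - T) + -κ * (t - T) = 0 := by ring
  rw [h4, Real.exp_zero, mul_one] at h3
  linarith

lemma tendsto_zero_of_hasDerivAt_le {V V' g : ℝ → ℝ} {κ : ℝ} (hκ : 0 < κ)
    (hV : ∀ t, HasDerivAt V (V' t) t) (hV0 : ∀ t, 0 ≤ V t)
    (h : ∀ t, V' t ≤ -κ * V t + g t) (hg : Tendsto g atTop (𝓝 0)) :
    Tendsto V atTop (𝓝 0) := by
  rw [Metric.tendsto_atTop]
  intro ε hε
  obtain ⟨T, hT⟩ := eventually_atTop.1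
    (hg.eventually (ge_mem_nhds (show (0 : ℝ) < κ * (ε / 2) by positivity)))
  have hb : ∀ t, T ≤ t → V t ≤ ε / 2 + (V T - ε / 2) * Real.exp (-κ * (t - T)) := fun t ht =>
    le_of_hasDerivAt_le_neg_mul hV (fun s hs => by linarith [h s, hT s hs]) ht
  have hlim : Tendsto (fun t => ε / 2 + (V T - ε / 2) * Real.exp (-κ * (t - T))) atTop
      (𝓝 (ε / 2 + (V T - ε / 2) * 0)) := by
    refine tendsto_const_nhds.add (tendsto_const_nhds.mul ?_)
    refine Real.tendsto_exp_atBot.comp ?_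
    exact (tendsto_atTop_add_const_right atTop (-T) tendsto_id).const_mul_atTop_of_neg
      (neg_lt_zero.2 hκ)
  obtain ⟨T', hT'⟩ := eventually_atTop.1
    (hlim.eventually (gt_mem_nhds (show ε / 2 + (V T - ε / 2) * 0 < ε by linarith)))
  refine ⟨max T T', fun t ht => ?_⟩
  rw [Real.dist_eq, sub_zero, abs_of_nonneg (hV0 t)]
  exact (hb t (le_of_max_le_left ht)).trans_lt (hT' t (le_of_max_le_right ht))

variable {ι : Type*} [Fintype ι]

lemma Matrix.IsHermitian.dotProduct_mulVec_comm {W : Matrix ι ι ℝ} (hW : W.IsHermitian)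
    (u v : ι → ℝ) : u ⬝ᵥ W *ᵥ v = v ⬝ᵥ W *ᵥ u := by
  have hT : Wᵀ = W := by simpa [IsHermitian] using hW
  rw [dotProduct_mulVec, ← mulVec_transpose, hT, dotProduct_comm]

lemma hasDerivAt_quadraticForm {W : Matrix ι ι ℝ} (hW : W.IsHermitian) {ζ : ℝ → ι → ℝ}
    {v : ι → ℝ} {t : ℝ} (h : HasDerivAt ζ v t) :
    HasDerivAt (fun s => ζ s ⬝ᵥ W *ᵥ ζ s) (2 * (ζ t ⬝ᵥ W *ᵥ v)) t := by
  have h1 : ∀ i, HasDerivAt (fun s => ζ s i) (v i) t := hasDerivAt_pi.1 h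
  have h2 : ∀ i, HasDerivAt (fun s => (W *ᵥ ζ s) i) ((W *ᵥ v) i) t := fun i =>
    HasDerivAt.fun_sum fun j _ => (h1 j).const_mul (W i j)
  have h3 : HasDerivAt (fun s => ζ s ⬝ᵥ W *ᵥ ζ s)
      (∑ i, (v i * (W *ᵥ ζ t) i + ζ t i * (W *ᵥ v) i)) t :=
    HasDerivAt.fun_sum fun i _ => (h1 i).mul (h2 i)
  refine h3.congr_deriv ?_
  rw [Finset.sum_add_distrib, two_mul]
  change v ⬝ᵥ W *ᵥ ζ t + ζ t ⬝ᵥ W *ᵥ v = _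
  rw [hW.dotProduct_mulVec_comm v]

variable [DecidableEq ι]

lemma exists_norm_le_mul_exp_of_lyapunov {W M : Matrix ι ι ℝ} (hW : W.PosDef) {κ : ℝ}
    (h : ∀ u, 2 * (u ⬝ᵥ W *ᵥ (M *ᵥ u)) ≤ -κ * (u ⬝ᵥ W *ᵥ u)) {ζ : ℝ → ι → ℝ}
    (hζ : ∀ t, HasDerivAt ζ (M *ᵥ ζ t) t) :
    ∃ C : ℝ, ∀ t : ℝ, 0 ≤ t → ‖ζ t‖ ≤ C * Real.exp (-(κ / 2) * t) := by
  obtain ⟨δ, hδ, hδW⟩ := exists_pos_mul_dotProduct_le hW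
  have hV0 : 0 ≤ ζ 0 ⬝ᵥ W *ᵥ ζ 0 := by
    simpa using hW.posSemidef.dotProduct_mulVec_nonneg (ζ 0)
  refine ⟨√((ζ 0 ⬝ᵥ W *ᵥ ζ 0) / δ), fun t ht => ?_⟩
  have h1 : ζ t ⬝ᵥ W *ᵥ ζ t ≤ (ζ 0 ⬝ᵥ W *ᵥ ζ 0) * Real.exp (-κ * t) := by
    have := le_of_hasDerivAt_le_neg_mul (ε := 0) (κ := κ)
      (fun s => hasDerivAt_quadraticForm hW.1 (hζ s)) (fun s _ => by simpa using h (ζ s)) ht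
    simpa using this
  refine le_of_sq_le_sq ?_ (by positivity)
  rw [mul_pow, Real.sq_sqrt (by positivity), ← Real.exp_nat_mul]
  have h2 : ((2 : ℕ) : ℝ) * (-(κ / 2) * t) = -κ * t := by push_cast; ring
  rw [h2, div_mul_eq_mul_div, le_div_iff₀ hδ]
  nlinarith [sq_norm_le_dotProduct (ζ t), hδW (ζ t)]

lemma isHurwitz_of_lyapunov {W M : Matrix ι ι ℝ} (hW : W.PosDef) {κ : ℝ} (hκ : 0 < κ)
    (h : ∀ u, 2 * (u ⬝ᵥ W *ᵥ (M *ᵥ u)) ≤ -κ * (u ⬝ᵥ W *ᵥ u)) : IsHurwitz M := by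
  intro μ hμ
  rw [← Matrix.spectrum_toLin', ← Module.End.hasEigenvalue_iff_mem_spectrum] at hμ
  obtain ⟨v, hv⟩ := hμ.exists_hasEigenvector
  have hMv : M.map Complex.ofReal *ᵥ v = μ • v := by simpa using hv.apply_eq_smul
  set x : ι → ℝ := fun i => (v i).re with hx
  set y : ι → ℝ := fun i => (v i).im with hy
  have hMx : M *ᵥ x = μ.re • x - μ.im • y := by
    ext i
    have := congrArg Complex.re (congrFun hMv i)
    simpa [mulVec, dotProduct, hx, hy] using this
  have hMy : M *ᵥ y = μ.im • x + μ.re • y := by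
    ext i
    have := congrArg Complex.im (congrFun hMv i)
    simp [mulVec, dotProduct, hx, hy] at this ⊢
    linarith
  have hsym := hW.1.dotProduct_mulVec_comm x y
  have h1 := h x
  have h2 := h y
  rw [hMx] at h1
  rw [hMy] at h2
  simp only [mulVec_sub, mulVec_add, mulVec_smul, dotProduct_sub, dotProduct_add, dotProduct_smul,
    smul_eq_mul] at h1 h2
  have hpos : 0 < x ⬝ᵥ W *ᵥ x + y ⬝ᵥ W *ᵥ y := by
    have hx0 : 0 ≤ x ⬝ᵥ W *ᵥ x := by simpa using hW.posSemidef.dotProduct_mulVec_nonneg x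
    have hy0 : 0 ≤ y ⬝ᵥ W *ᵥ y := by simpa using hW.posSemidef.dotProduct_mulVec_nonneg y
    by_cases hxz : x = 0
    · have hyz : y ≠ 0 := by
        intro hyz
        refine hv.2 (funext fun i => Complex.ext ?_ ?_)
        · exact congrFun hxz i
        · exact congrFun hyz i
      have : 0 < y ⬝ᵥ W *ᵥ y := by simpa using hW.dotProduct_mulVec_pos hyz
      linarith
    · have : 0 < x ⬝ᵥ W *ᵥ x := by simpa using hW.dotProduct_mulVec_pos hxz
      linarith
  rw [hsym] at h1
  by_contra! hre
  nlinarith [mul_nonneg hre hpos.le, mul_pos hκ hpos]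

lemma tendsto_zero_of_lyapunov_forced {P H : Matrix ι ι ℝ} (hP : P.PosDef)
    (h : ∀ u, 2 * (u ⬝ᵥ P *ᵥ (H *ᵥ u)) ≤ -(u ⬝ᵥ u)) {η f : ℝ → ι → ℝ}
    (hη : ∀ t, HasDerivAt η (H *ᵥ η t + f t) t) (hf : Tendsto f atTop (𝓝 0)) :
    Tendsto η atTop (𝓝 0) := by
  obtain ⟨δ, hδ, hδP⟩ := exists_pos_mul_dotProduct_le hP
  set m : ℝ := |maxEig P| + 1
  have hm0 : 0 < m := by positivity
  have hupper : ∀ u : ι → ℝ, u ⬝ᵥ P *ᵥ u ≤ m * (u ⬝ᵥ u) := fun u => by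
    have h1 := (posSemidef_maxEig_sub hP.1).dotProduct_mulVec_nonneg u
    have h2 : u ⬝ᵥ P *ᵥ u ≤ maxEig P * (u ⬝ᵥ u) := by
      simpa [sub_mulVec, smul_mulVec] using h1
    have h3 : 0 ≤ u ⬝ᵥ u := by simpa using dotProduct_star_self_nonneg u
    nlinarith [le_abs_self (maxEig P)]
  have hV : Tendsto (fun t => η t ⬝ᵥ P *ᵥ η t) atTop (𝓝 0) := by
    refine tendsto_zero_of_hasDerivAt_le (κ := 1 / (2 * m))
      (g := fun t => 2 * ((P *ᵥ f t) ⬝ᵥ (P *ᵥ f t))) (by positivity)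
      (fun t => hasDerivAt_quadraticForm hP.1 (hη t))
      (fun t => by simpa using hP.posSemidef.dotProduct_mulVec_nonneg (η t)) (fun t => ?_) ?_
    · rw [mulVec_add, dotProduct_add]
      have hyoung : 0 ≤ (η t - (2 : ℝ) • P *ᵥ f t) ⬝ᵥ (η t - (2 : ℝ) • P *ᵥ f t) := by
        simpa using dotProduct_star_self_nonneg (η t - (2 : ℝ) • P *ᵥ f t)
      simp only [sub_dotProduct, dotProduct_sub, smul_dotProduct, dotProduct_smul,
        smul_eq_mul, dotProduct_comm (P *ᵥ f t) (η t)] at hyoung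
      have h4 : 1 / (2 * m) * (η t ⬝ᵥ P *ᵥ η t) ≤ 1 / 2 * (η t ⬝ᵥ η t) := by
        rw [div_mul_eq_mul_div, one_mul, div_le_iff₀ (by positivity)]
        linarith [hupper (η t)]
      linarith [h (η t)]
    · have hc : Continuous fun w : ι → ℝ => 2 * ((P *ᵥ w) ⬝ᵥ (P *ᵥ w)) := by fun_prop
      simpa [Function.comp_def] using (hc.tendsto 0).comp hf
  rw [tendsto_zero_iff_norm_tendsto_zero]
  have hsq : Tendsto (fun t => ‖η t‖ ^ 2) atTop (𝓝 0) := by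
    refine squeeze_zero (fun t => sq_nonneg _) (fun t => ?_) (g := fun t =>
      (η t ⬝ᵥ P *ᵥ η t) / δ) (by simpa using hV.div_const δ)
    rw [le_div_iff₀ hδ]
    nlinarith [sq_norm_le_dotProduct (η t), hδP (η t)]
  simpa using hsq.sqrt

end Lyapunov

section ClusterMatrix

variable {n N : ℕ} {l : Fin N → ℕ}

lemma eq_blockDiagonal'_diagBlock
    {W : Matrix ((i : Fin N) × Fin (l i - 1)) ((i : Fin N) × Fin (l i - 1)) ℝ}
    (hW : ∀ p q, p.1 ≠ q.1 → W p q = 0) : W = blockDiagonal' (diagBlock W) := by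
  ext ⟨i, p⟩ ⟨j, q⟩
  by_cases h : i = j
  · subst h
    simp [diagBlock]
  · rw [blockDiagonal'_apply_ne _ _ _ h]
    exact hW _ _ h

lemma reducedLapWeighted_eq (ci : Fin N → ℝ)
    (b : ((i : Fin N) × Fin (l i)) → ((i : Fin N) × Fin (l i)) → ℝ) :
    reducedLapWeighted N l ci b =
      blockDiagonal' (fun i => ci i • diagBlock (reducedLap N l b) i) + reducedLapOff N l b := by
  ext ⟨i, p⟩ ⟨j, q⟩
  by_cases h : i = j
  · subst h
    simp [diagBlock, reducedLapWeighted, reducedLapOff]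
  · simp [reducedLapWeighted, reducedLapOff, blockDiagonal'_apply_ne _ _ _ h, h]

lemma posSemidef_smul_sub_smul_one {ι : Type*} [Fintype ι] [DecidableEq ι] {Q : Matrix ι ι ℝ}
    (hQ : Q.PosDef) {s r : ℝ} (hr : 0 ≤ r) (h : s / minEig Q ≤ r) :
    (r • Q - s • (1 : Matrix ι ι ℝ)).PosSemidef := by
  rcases isEmpty_or_nonempty ι with hι | hι
  · rw [Subsingleton.elim (r • Q - s • (1 : Matrix ι ι ℝ)) 0]
    exact .zero
  · rw [div_le_iff₀ (minEig_pos hQ)] at h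
    have heq : r • Q - s • (1 : Matrix ι ι ℝ) =
        r • (Q - minEig Q • (1 : Matrix ι ι ℝ)) + (r * minEig Q - s) • (1 : Matrix ι ι ℝ) := by
      module
    rw [heq]
    exact ((posSemidef_sub_minEig hQ.1).smul hr).add (PosSemidef.one.smul (sub_nonneg.2 h))

lemma posSemidef_lyapunov_reducedLapWeighted {ci : Fin N → ℝ} (hci : ∀ i, 0 < ci i)
    {b : ((i : Fin N) × Fin (l i)) → ((i : Fin N) × Fin (l i)) → ℝ}
    {W : Matrix ((i : Fin N) × Fin (l i - 1)) ((i : Fin N) × Fin (l i - 1)) ℝ}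
    (hWblock : ∀ p q, p.1 ≠ q.1 → W p q = 0) (hW : W.IsHermitian)
    (hWLpd : ∀ i : Fin N,
      (diagBlock W i * diagBlock (reducedLap N l b) i +
        (diagBlock (reducedLap N l b) i)ᵀ * diagBlock W i).PosDef)
    (hcloc : ∀ i : Fin N,
      (maxEig W - minEig (W * reducedLapOff N l b + (reducedLapOff N l b)ᵀ * W)) /
        minEig (diagBlock W i * diagBlock (reducedLap N l b) i +
          (diagBlock (reducedLap N l b) i)ᵀ * diagBlock W i) ≤ ci i) :
    (W * reducedLapWeighted N l ci b + (reducedLapWeighted N l ci b)ᵀ * W - W).PosSemidef := by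
  set L := reducedLap N l b
  set O := reducedLapOff N l b
  set s := maxEig W - minEig (W * O + Oᵀ * W) with hs
  have hWT : Wᵀ = W := by simpa [IsHermitian] using hW
  have hO : (W * O + Oᵀ * W).IsHermitian := by
    simp [IsHermitian, hWT, add_comm]
  have hblocks := posSemidef_blockDiagonal' fun i =>
    posSemidef_smul_sub_smul_one (hWLpd i) (hci i).le (hcloc i)
  have hdiag : W * blockDiagonal' (fun i => ci i • diagBlock L i) +
      (blockDiagonal' (fun i => ci i • diagBlock L i))ᵀ * W =
      blockDiagonal' (fun i => ci i • (diagBlock W i * diagBlock L i +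
        (diagBlock L i)ᵀ * diagBlock W i) - s • (1 : Matrix _ _ ℝ)) +
        s • (1 : Matrix _ _ ℝ) := by
    have hone : s • (1 : Matrix ((i : Fin N) × Fin (l i - 1)) ((i : Fin N) × Fin (l i - 1)) ℝ) =
        blockDiagonal' fun i => s • (1 : Matrix (Fin (l i - 1)) (Fin (l i - 1)) ℝ) := by
      rw [← blockDiagonal'_one, ← blockDiagonal'_smul]
      rfl
    rw [hone, ← blockDiagonal'_add, eq_blockDiagonal'_diagBlock hWblock,
      blockDiagonal'_transpose, ← blockDiagonal'_mul, ← blockDiagonal'_mul, ← blockDiagonal'_add,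
      ← eq_blockDiagonal'_diagBlock hWblock]
    congr 1
    ext1 i
    simp [smul_add]
  have heq : W * reducedLapWeighted N l ci b + (reducedLapWeighted N l ci b)ᵀ * W - W =
      blockDiagonal' (fun i => ci i • (diagBlock W i * diagBlock L i +
        (diagBlock L i)ᵀ * diagBlock W i) - s • (1 : Matrix _ _ ℝ)) +
      (W * O + Oᵀ * W - minEig (W * O + Oᵀ * W) • (1 : Matrix _ _ ℝ)) +
      (maxEig W • (1 : Matrix _ _ ℝ) - W) := by
    have hsub := eq_sub_of_add_eq hdiag.symm
    rw [hsub, reducedLapWeighted_eq, mul_add, transpose_add, add_mul, hs, sub_smul]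
    abel
  rw [heq]
  exact (hblocks.add (posSemidef_sub_minEig hO)).add (posSemidef_maxEig_sub hW)

open scoped Kronecker

lemma commute_kronecker_one_hatA
    {W : Matrix ((i : Fin N) × Fin (l i - 1)) ((i : Fin N) × Fin (l i - 1)) ℝ}
    (hWblock : ∀ p q, p.1 ≠ q.1 → W p q = 0) (A : Fin N → Matrix (Fin n) (Fin n) ℝ) :
    Commute (W ⊗ₖ (1 : Matrix (Fin n) (Fin n) ℝ)) (hatA n N l A) := by
  ext ⟨p, u⟩ ⟨q, v⟩
  have h1 : ((W ⊗ₖ (1 : Matrix (Fin n) (Fin n) ℝ)) * hatA n N l A) (p, u) (q, v) =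
      W p q * A q.1 u v := by
    simp [mul_apply, hatA, Fintype.sum_prod_type, one_apply]
  have h2 : (hatA n N l A * (W ⊗ₖ (1 : Matrix (Fin n) (Fin n) ℝ))) (p, u) (q, v) =
      A p.1 u v * W p q := by
    simp [mul_apply, hatA, Fintype.sum_prod_type, one_apply]
  rw [h1, h2]
  by_cases h : p.1 = q.1
  · rw [h, mul_comm]
  · rw [hWblock p q h]
    simp

lemma hatA_transpose (A : Fin N → Matrix (Fin n) (Fin n) ℝ) :
    (hatA n N l A)ᵀ = hatA n N l fun i => (A i)ᵀ := by
  ext ⟨p, u⟩ ⟨q, v⟩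
  by_cases h : p = q
  · subst h
    simp [hatA]
  · simp [hatA, h, Ne.symm h]

lemma hatA_mulVec (A : Fin N → Matrix (Fin n) (Fin n) ℝ)
    (x : ((i : Fin N) × Fin (l i - 1)) × Fin n → ℝ) (p : (i : Fin N) × Fin (l i - 1))
    (u : Fin n) : (hatA n N l A *ᵥ x) (p, u) = (A p.1 *ᵥ fun v => x (p, v)) u := by
  simp [mulVec, dotProduct, hatA, Fintype.sum_prod_type]

lemma maxEig_hatA_lt [Nonempty (((i : Fin N) × Fin (l i - 1)) × Fin n)]
    {A : Fin N → Matrix (Fin n) (Fin n) ℝ} {c : ℝ}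
    (hc : ∀ i : Fin N, maxEig (A i + (A i)ᵀ) < c) :
    maxEig (hatA n N l A + (hatA n N l A)ᵀ) < c := by
  refine maxEig_lt (by simp [IsHermitian, add_comm]) fun x hx => ?_
  have h1 : x ⬝ᵥ (hatA n N l A + (hatA n N l A)ᵀ) *ᵥ x =
      ∑ p : (i : Fin N) × Fin (l i - 1),
        (fun v => x (p, v)) ⬝ᵥ (A p.1 + (A p.1)ᵀ) *ᵥ fun v => x (p, v) := by
    rw [hatA_transpose, add_mulVec]
    simp [dotProduct, Fintype.sum_prod_type, hatA_mulVec, add_mulVec]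
  have h2 : c * (x ⬝ᵥ x) =
      ∑ p : (i : Fin N) × Fin (l i - 1), c * ((fun v => x (p, v)) ⬝ᵥ fun v => x (p, v)) := by
    simp [dotProduct, Fintype.sum_prod_type, Finset.mul_sum]
  have h3 : ∀ (i : Fin N) (y : Fin n → ℝ),
      y ⬝ᵥ (A i + (A i)ᵀ) *ᵥ y ≤ maxEig (A i + (A i)ᵀ) * (y ⬝ᵥ y) := fun i y => by
    have hH : (A i + (A i)ᵀ).IsHermitian := by simp [IsHermitian, add_comm]
    have := (posSemidef_maxEig_sub hH).dotProduct_mulVec_nonneg y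
    rw [star_trivial, sub_mulVec, dotProduct_sub, smul_mulVec, one_mulVec, dotProduct_smul,
      smul_eq_mul] at this
    linarith
  have h4 : ∀ y : Fin n → ℝ, 0 ≤ y ⬝ᵥ y := fun y => by
    simpa using dotProduct_star_self_nonneg y
  rw [h1, h2]
  obtain ⟨⟨p, u⟩, hp⟩ := Function.ne_iff.1 hx
  refine Finset.sum_lt_sum (fun q _ => (h3 _ _).trans ?_) ⟨p, Finset.mem_univ p, (h3 _ _).trans_lt ?_⟩
  · exact mul_le_mul_of_nonneg_right (hc _).le (h4 _)
  · refine mul_lt_mul_of_pos_right (hc _) ?_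
    have hne : (fun v => x (p, v)) ≠ 0 := fun h0 => hp (congrFun h0 u)
    simpa using (dotProduct_star_self_pos_iff (v := fun v => x (p, v))).2 hne

lemma clusterMatrix_lyapunov {c : ℝ} (hc : 0 < c) {ci : Fin N → ℝ}
    {A : Fin N → Matrix (Fin n) (Fin n) ℝ}
    {b : ((i : Fin N) × Fin (l i)) → ((i : Fin N) × Fin (l i)) → ℝ}
    {W : Matrix ((i : Fin N) × Fin (l i - 1)) ((i : Fin N) × Fin (l i - 1)) ℝ}
    (hWblock : ∀ p q, p.1 ≠ q.1 → W p q = 0) (hW : W.PosDef)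
    (hWL : (W * reducedLapWeighted N l ci b + (reducedLapWeighted N l ci b)ᵀ * W - W).PosSemidef)
    (u : ((i : Fin N) × Fin (l i - 1)) × Fin n → ℝ) :
    2 * (u ⬝ᵥ (W ⊗ₖ (1 : Matrix (Fin n) (Fin n) ℝ)) *ᵥ (clusterMatrix n N l c ci A b *ᵥ u)) ≤
      -(c - maxEig (hatA n N l A + (hatA n N l A)ᵀ)) *
        (u ⬝ᵥ (W ⊗ₖ (1 : Matrix (Fin n) (Fin n) ℝ)) *ᵥ u) := by
  set 𝒲 := W ⊗ₖ (1 : Matrix (Fin n) (Fin n) ℝ) with h𝒲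
  set 𝒜 := hatA n N l A with h𝒜
  set r := maxEig (𝒜 + 𝒜ᵀ)
  set L := reducedLapWeighted N l ci b
  have h𝒲psd : 𝒲.PosSemidef := hW.posSemidef.kronecker .one
  have hcomm : Commute 𝒲 (r • (1 : Matrix _ _ ℝ) - (𝒜 + 𝒜ᵀ)) := by
    refine .sub_right (.smul_right (.one_right _) _) (.add_right ?_ ?_)
    · exact commute_kronecker_one_hatA hWblock A
    · rw [h𝒜, hatA_transpose]
      exact commute_kronecker_one_hatA hWblock _
  have hdrift := (h𝒲psd.mul_of_commute
    (posSemidef_maxEig_sub (M := 𝒜 + 𝒜ᵀ) (by simp [IsHermitian, add_comm]))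
    hcomm).dotProduct_mulVec_nonneg u
  have hcoupling := ((hWL.kronecker (PosSemidef.one (n := Fin n) (R := ℝ))).smul
    hc.le).dotProduct_mulVec_nonneg u
  have hexpand : (W * L + Lᵀ * W - W) ⊗ₖ (1 : Matrix (Fin n) (Fin n) ℝ) =
      𝒲 * (L ⊗ₖ 1) + (L ⊗ₖ 1)ᵀ * 𝒲 - 𝒲 := by
    rw [h𝒲, ← kroneckerMap_transpose, ← mul_kronecker_mul, transpose_one, ← mul_kronecker_mul]
    ext ⟨p, x⟩ ⟨q, y⟩
    simp
    ring
  have hflip : ∀ M : Matrix (((i : Fin N) × Fin (l i - 1)) × Fin n) _ ℝ,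
      u ⬝ᵥ (Mᵀ * 𝒲) *ᵥ u = u ⬝ᵥ (𝒲 * M) *ᵥ u := fun M => by
    rw [← mulVec_mulVec, ← mulVec_mulVec, h𝒲psd.1.dotProduct_mulVec_comm u, dotProduct_mulVec,
      vecMul_transpose, dotProduct_comm, dotProduct_comm, h𝒲psd.1.dotProduct_mulVec_comm _ u,
      h𝒲psd.1.dotProduct_mulVec_comm u]
  have hdriftT : u ⬝ᵥ (𝒲 * 𝒜ᵀ) *ᵥ u = u ⬝ᵥ (𝒲 * 𝒜) *ᵥ u := by
    rw [← hflip 𝒜, h𝒜, hatA_transpose, (commute_kronecker_one_hatA hWblock _).eq]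
  rw [hexpand] at hcoupling
  simp only [star_trivial, mul_sub, mul_add, mul_smul_comm, mul_one, sub_mulVec, add_mulVec,
    smul_mulVec, dotProduct_sub, dotProduct_add, dotProduct_smul, smul_eq_mul, hflip, hdriftT]
    at hdrift hcoupling
  have hM : u ⬝ᵥ 𝒲 *ᵥ (clusterMatrix n N l c ci A b *ᵥ u) =
      u ⬝ᵥ (𝒲 * 𝒜) *ᵥ u - c * (u ⬝ᵥ (𝒲 * (L ⊗ₖ 1)) *ᵥ u) := by
    rw [mulVec_mulVec, clusterMatrix, mul_sub, mul_smul_comm, sub_mulVec, smul_mulVec,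
      dotProduct_sub, dotProduct_smul, smul_eq_mul]
  rw [hM]
  linarith

end ClusterMatrix

section ClosedLoop

lemma sum_neg_smul_sub_eq_of_sum_eq_zero {E : Type*} [AddCommGroup E] [Module ℝ E] {m : ℕ}
    (hm : 1 ≤ m) {β : Fin m → ℝ} (hβ : ∑ k, β k = 0) (z : E) (y : Fin m → E) :
    ∑ k, (-β k) • (z - y k) =
      ∑ q : Fin (m - 1), β ⟨q.1 + 1, by omega⟩ • (y ⟨q.1 + 1, by omega⟩ - y ⟨0, by omega⟩) := by
  obtain ⟨m, rfl⟩ : ∃ k, m = k + 1 := ⟨m - 1, by omega⟩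
  have h1 : ∑ k, (-β k) • (z - y k) = ∑ k, β k • (y k - y 0) := by
    have h2 : ∀ k, (-β k) • (z - y k) = β k • (y k - y 0) + β k • (y 0 - z) := fun k => by module
    simp_rw [h2]
    rw [Finset.sum_add_distrib, ← Finset.sum_smul, hβ, zero_smul, add_zero]
  rw [h1, Fin.sum_univ_succ, sub_self, smul_zero, zero_add]
  rfl

variable {n N : ℕ} {l : Fin N → ℕ}

lemma coupling_eq_sum_reduced {E : Type*} [AddCommGroup E] [Module ℝ E] (hl : ∀ i, 1 ≤ l i)
    {a b : ((i : Fin N) × Fin (l i)) → ((i : Fin N) × Fin (l i)) → ℝ}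
    (hab : ∀ v w, v ≠ w → a v w = -b v w)
    (hrow : ∀ (i j : Fin N) (p : Fin (l i)), ∑ q : Fin (l j), b ⟨i, p⟩ ⟨j, q⟩ = 0)
    (ci : Fin N → ℝ) (i : Fin N) (p : Fin (l i)) (y : (i : Fin N) × Fin (l i) → E) :
    ci i • ∑ k : Fin (l i), a ⟨i, p⟩ ⟨i, k⟩ • (y ⟨i, p⟩ - y ⟨i, k⟩) +
        ∑ w : (j : Fin N) × Fin (l j),
          (if w.1 = i then 0 else a ⟨i, p⟩ w • (y ⟨i, p⟩ - y w)) =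
      ∑ q : (j : Fin N) × Fin (l j - 1),
        ((if i = q.1 then ci i else 1) * b ⟨i, p⟩ ⟨q.1, ⟨q.2.1 + 1, by have := q.2.2; omega⟩⟩) •
          (y ⟨q.1, ⟨q.2.1 + 1, by have := q.2.2; omega⟩⟩ -
            y ⟨q.1, ⟨0, by have := q.2.2; omega⟩⟩) := by
  have hterm : ∀ w, a ⟨i, p⟩ w • (y ⟨i, p⟩ - y w) = (-b ⟨i, p⟩ w) • (y ⟨i, p⟩ - y w) := by
    intro w
    by_cases h : (⟨i, p⟩ : (i : Fin N) × Fin (l i)) = w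
    · simp [← h]
    · rw [hab _ _ h]
  have hblock : ∀ j, ∑ k : Fin (l j), a ⟨i, p⟩ ⟨j, k⟩ • (y ⟨i, p⟩ - y ⟨j, k⟩) =
      ∑ q : Fin (l j - 1), b ⟨i, p⟩ ⟨j, ⟨q.1 + 1, by omega⟩⟩ •
        (y ⟨j, ⟨q.1 + 1, by omega⟩⟩ - y ⟨j, ⟨0, hl j⟩⟩) := fun j => by
    simp_rw [hterm]
    exact sum_neg_smul_sub_eq_of_sum_eq_zero (hl j) (hrow i j p) _ fun k => y ⟨j, k⟩
  rw [Fintype.sum_sigma, Fintype.sum_sigma]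
  have hsplit : ci i • ∑ k : Fin (l i), a ⟨i, p⟩ ⟨i, k⟩ • (y ⟨i, p⟩ - y ⟨i, k⟩) =
      ∑ j, if j = i then
        ci i • ∑ k : Fin (l j), a ⟨i, p⟩ ⟨j, k⟩ • (y ⟨i, p⟩ - y ⟨j, k⟩) else 0 := by
    simp
  rw [hsplit, ← Finset.sum_add_distrib]
  refine Finset.sum_congr rfl fun j _ => ?_
  by_cases h : j = i
  · subst h
    simp only [if_true, Finset.sum_const_zero, add_zero, hblock, Finset.smul_sum, smul_smul]
  · simp only [h, Ne.symm h, if_false, zero_add, hblock, one_mul]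

/-- Differences to the first agent of each cluster, stacked into one vector. -/
noncomputable def clusterError (y : (i : Fin N) × Fin (l i) → Fin n → ℝ) :
    ((i : Fin N) × Fin (l i - 1)) × Fin n → ℝ := fun q =>
  (y ⟨q.1.1, ⟨q.1.2.1 + 1, by have := q.1.2.2; omega⟩⟩ -
    y ⟨q.1.1, ⟨0, by have := q.1.2.2; omega⟩⟩) q.2

lemma clusterMatrix_mulVec (c : ℝ) (ci : Fin N → ℝ) (A : Fin N → Matrix (Fin n) (Fin n) ℝ)
    (b : ((i : Fin N) × Fin (l i)) → ((i : Fin N) × Fin (l i)) → ℝ)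
    (x : ((i : Fin N) × Fin (l i - 1)) × Fin n → ℝ) (p : (i : Fin N) × Fin (l i - 1))
    (u : Fin n) :
    (clusterMatrix n N l c ci A b *ᵥ x) (p, u) =
      (A p.1 *ᵥ fun v => x (p, v)) u - c * ∑ q, reducedLapWeighted N l ci b p q * x (q, u) := by
  rw [clusterMatrix, sub_mulVec, smul_mulVec, Pi.sub_apply, hatA_mulVec]
  simp [mulVec, dotProduct, Fintype.sum_prod_type, one_apply]

lemma hasDerivAt_clusterError {c : ℝ} {ci : Fin N → ℝ} {A : Fin N → Matrix (Fin n) (Fin n) ℝ}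
    {b : ((i : Fin N) × Fin (l i)) → ((i : Fin N) × Fin (l i)) → ℝ}
    {y : (i : Fin N) × Fin (l i) → ℝ → Fin n → ℝ} {t : ℝ}
    (hy : ∀ (i : Fin N) (p : Fin (l i)), HasDerivAt (y ⟨i, p⟩)
      (A i *ᵥ y ⟨i, p⟩ t - c • ∑ q : (j : Fin N) × Fin (l j - 1),
        ((if i = q.1 then ci i else 1) * b ⟨i, p⟩ ⟨q.1, ⟨q.2.1 + 1, by have := q.2.2; omega⟩⟩) •
          fun u => clusterError (fun v => y v t) (q, u)) t) :
    HasDerivAt (fun s => clusterError fun v => y v s)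
      (clusterMatrix n N l c ci A b *ᵥ clusterError fun v => y v t) t := by
  rw [hasDerivAt_pi]
  rintro ⟨p, u⟩
  have h1 := hasDerivAt_pi.1 (hy p.1 ⟨p.2.1 + 1, by have := p.2.2; omega⟩) u
  have h0 := hasDerivAt_pi.1 (hy p.1 ⟨0, by have := p.2.2; omega⟩) u
  refine (h1.sub h0).congr_deriv ?_
  have hA : (fun v => clusterError (fun w => y w t) (p, v)) =
      y ⟨p.1, ⟨p.2.1 + 1, by have := p.2.2; omega⟩⟩ t -
        y ⟨p.1, ⟨0, by have := p.2.2; omega⟩⟩ t := rfl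
  have hL : ∀ q, reducedLapWeighted N l ci b p q * clusterError (fun w => y w t) (q, u) =
      (if p.1 = q.1 then ci p.1 else 1) * b ⟨p.1, ⟨p.2.1 + 1, by have := p.2.2; omega⟩⟩
        ⟨q.1, ⟨q.2.1 + 1, by have := q.2.2; omega⟩⟩ * clusterError (fun w => y w t) (q, u) -
      (if p.1 = q.1 then ci p.1 else 1) * b ⟨p.1, ⟨0, by have := p.2.2; omega⟩⟩
        ⟨q.1, ⟨q.2.1 + 1, by have := q.2.2; omega⟩⟩ * clusterError (fun w => y w t) (q, u) := by
    intro q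
    simp only [reducedLapWeighted, reducedLap, of_apply]
    ring
  rw [clusterMatrix_mulVec, hA, mulVec_sub]
  simp_rw [hL]
  rw [Finset.sum_sub_distrib]
  simp only [Pi.sub_apply, Pi.smul_apply, Finset.sum_apply, smul_eq_mul]
  ring

lemma riccati_lyapunov {ι κ : Type*} [Fintype ι] [DecidableEq ι] [Fintype κ]
    {A P : Matrix ι ι ℝ} {B : Matrix ι κ ℝ} (hP : P.PosDef)
    (hRic : P * A + Aᵀ * P - P * B * Bᵀ * P = -1) (u : ι → ℝ) :
    2 * (u ⬝ᵥ P *ᵥ ((A + B * -(Bᵀ * P)) *ᵥ u)) ≤ -(u ⬝ᵥ u) := by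
  have hsym : Pᵀ = P := by simpa [IsHermitian] using hP.1
  have hA : u ⬝ᵥ (Aᵀ * P) *ᵥ u = u ⬝ᵥ (P * A) *ᵥ u := by
    rw [← mulVec_mulVec, ← mulVec_mulVec, dotProduct_mulVec, vecMul_transpose,
      hP.1.dotProduct_mulVec_comm]
  have hB : 0 ≤ u ⬝ᵥ (P * B * Bᵀ * P) *ᵥ u := by
    have h := (posSemidef_self_mul_conjTranspose (P * B)).dotProduct_mulVec_nonneg u
    simpa [hsym, Matrix.mul_assoc] using h
  have hR := congrArg (fun M => u ⬝ᵥ M *ᵥ u) hRic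
  simp only [sub_mulVec, add_mulVec, neg_mulVec, one_mulVec, dotProduct_sub, dotProduct_add,
    dotProduct_neg, hA] at hR
  have hK : u ⬝ᵥ P *ᵥ ((A + B * -(Bᵀ * P)) *ᵥ u) =
      u ⬝ᵥ (P * A) *ᵥ u - u ⬝ᵥ (P * B * Bᵀ * P) *ᵥ u := by
    rw [mulVec_mulVec, Matrix.mul_add, Matrix.mul_neg, Matrix.mul_neg, ← sub_eq_add_neg,
      sub_mulVec, dotProduct_sub]
    simp only [Matrix.mul_assoc]
  rw [hK]
  linarith

lemma closedLoop_tendsto (hl : ∀ i, 1 ≤ l i) {m : Fin N → ℕ}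
    {A : Fin N → Matrix (Fin n) (Fin n) ℝ} {B : (i : Fin N) → Matrix (Fin n) (Fin (m i)) ℝ}
    {P : Fin N → Matrix (Fin n) (Fin n) ℝ} (hP : ∀ i, (P i).PosDef)
    (hRic : ∀ i, P i * A i + (A i)ᵀ * P i - P i * B i * (B i)ᵀ * P i = -1)
    {K : (i : Fin N) → Matrix (Fin (m i)) (Fin n) ℝ} (hK : ∀ i, K i = -((B i)ᵀ * P i))
    {a b : ((i : Fin N) × Fin (l i)) → ((i : Fin N) × Fin (l i)) → ℝ}
    (hab : ∀ v w, v ≠ w → a v w = -b v w)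
    (hrow : ∀ (i j : Fin N) (p : Fin (l i)), ∑ q : Fin (l j), b ⟨i, p⟩ ⟨j, q⟩ = 0)
    {c : ℝ} {ci : Fin N → ℝ}
    (hstable : ∀ ζ : ℝ → ((((i : Fin N) × Fin (l i - 1)) × Fin n) → ℝ),
      (∀ t, HasDerivAt ζ (clusterMatrix n N l c ci A b *ᵥ ζ t) t) → Tendsto ζ atTop (𝓝 0))
    {x η : ((i : Fin N) × Fin (l i)) → ℝ → (Fin n → ℝ)}
    (hx : ∀ (i : Fin N) (p : Fin (l i)) (t : ℝ),
      HasDerivAt (x ⟨i, p⟩) (A i *ᵥ x ⟨i, p⟩ t + (B i * K i) *ᵥ η ⟨i, p⟩ t) t)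
    (hη : ∀ (i : Fin N) (p : Fin (l i)) (t : ℝ),
      HasDerivAt (η ⟨i, p⟩)
        ((A i + B i * K i) *ᵥ η ⟨i, p⟩ t +
          c • (ci i •
              ∑ k : Fin (l i), a ⟨i, p⟩ ⟨i, k⟩ •
                (η ⟨i, k⟩ t - η ⟨i, p⟩ t + x ⟨i, p⟩ t - x ⟨i, k⟩ t) +
            ∑ w : (j : Fin N) × Fin (l j),
              if w.1 = i then 0 else a ⟨i, p⟩ w •
                (η w t - η ⟨i, p⟩ t + x ⟨i, p⟩ t - x w t))) t) :
    (∀ (i : Fin N) (p q : Fin (l i)),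
        Tendsto (fun t => x ⟨i, p⟩ t - x ⟨i, q⟩ t) atTop (𝓝 0)) ∧
      ∀ v : (i : Fin N) × Fin (l i), Tendsto (η v) atTop (𝓝 0) := by
  set y : ((i : Fin N) × Fin (l i)) → ℝ → Fin n → ℝ := fun v t => x v t - η v t with hy
  set ζ : ℝ → ((((i : Fin N) × Fin (l i - 1)) × Fin n) → ℝ) :=
    fun t => clusterError fun v => y v t with hζ
  set f : (i : Fin N) → Fin (l i) → ℝ → Fin n → ℝ := fun i p t =>
    c • ∑ q : (j : Fin N) × Fin (l j - 1),
      ((if i = q.1 then ci i else 1) * b ⟨i, p⟩ ⟨q.1, ⟨q.2.1 + 1, by have := q.2.2; omega⟩⟩) •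
        fun u => ζ t (q, u) with hf
  have hη' : ∀ (i : Fin N) (p : Fin (l i)) (t : ℝ),
      HasDerivAt (η ⟨i, p⟩) ((A i + B i * K i) *ᵥ η ⟨i, p⟩ t + f i p t) t := by
    intro i p t
    refine (hη i p t).congr_deriv ?_
    have hdiff : ∀ v w, η w t - η v t + x v t - x w t = y v t - y w t := fun v w => by
      simp only [hy]
      abel
    simp_rw [hdiff]
    rw [coupling_eq_sum_reduced hl hab hrow ci i p fun v => y v t]
    rfl
  have hydyn : ∀ (i : Fin N) (p : Fin (l i)) (t : ℝ),
      HasDerivAt (y ⟨i, p⟩) (A i *ᵥ y ⟨i, p⟩ t - f i p t) t := by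
    intro i p t
    refine ((hx i p t).sub (hη' i p t)).congr_deriv ?_
    rw [hy, mulVec_sub, add_mulVec]
    abel
  have hζ0 : Tendsto ζ atTop (𝓝 0) :=
    hstable ζ fun t => hasDerivAt_clusterError fun i p => hydyn i p t
  have hζq : ∀ q, Tendsto (fun t u => ζ t (q, u)) atTop (𝓝 0) := fun q =>
    tendsto_pi_nhds.2 fun u => tendsto_pi_nhds.1 hζ0 (q, u)
  have hf0 : ∀ i p, Tendsto (f i p) atTop (𝓝 0) := by
    intro i p
    have := (tendsto_finsetSum Finset.univ fun (q : (j : Fin N) × Fin (l j - 1)) _ =>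
      (hζq q).const_smul ((if i = q.1 then ci i else 1) *
        b ⟨i, p⟩ ⟨q.1, ⟨q.2.1 + 1, by have := q.2.2; omega⟩⟩)).const_smul c
    simpa only [smul_zero, Finset.sum_const_zero] using this
  have hη0 : ∀ v, Tendsto (η v) atTop (𝓝 0) := by
    rintro ⟨i, p⟩
    refine tendsto_zero_of_lyapunov_forced (hP i) (fun u => ?_) (hη' i p) (hf0 i p)
    rw [hK i]
    exact riccati_lyapunov (hP i) (hRic i) u
  have hy0 : ∀ (i : Fin N) (p : Fin (l i)),
      Tendsto (fun t => y ⟨i, p⟩ t - y ⟨i, ⟨0, hl i⟩⟩ t) atTop (𝓝 0) := by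
    rintro i ⟨_ | p, hp⟩
    · simp
    · exact hζq ⟨i, ⟨p, by omega⟩⟩
  refine ⟨fun i p q => ?_, hη0⟩
  have hlim := ((hy0 i p).sub (hy0 i q)).add ((hη0 ⟨i, p⟩).sub (hη0 ⟨i, q⟩))
  simp only [sub_zero, add_zero] at hlim
  refine hlim.congr fun t => ?_
  simp only [hy]
  abel

end ClosedLoop

/-- Theorem 2: under cooperative intra-cluster edges, directed spanning trees in every
subgraph, `c > max_i λ_max(A_i + A_iᵀ)`, and the lower bounds on the local weighting
factors `c_i`, the matrix `Â - c L̂_c ⊗ I_n` is Hurwitz, every solution of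
`ζ' = (Â - c L̂_c ⊗ I_n) ζ` decays exponentially with rate at least
`(c - λ_max(Â + Âᵀ))/2`, and the closed-loop multi-agent system achieves intra-cluster
state synchronization with vanishing auxiliary variables. -/
theorem cluster_synchronization_spanning_tree
    (n N : ℕ) (l : Fin N → ℕ) (hl : ∀ i, 1 ≤ l i) (m : Fin N → ℕ)
    (A : Fin N → Matrix (Fin n) (Fin n) ℝ)
    (B : (i : Fin N) → Matrix (Fin n) (Fin (m i)) ℝ)
    (P : Fin N → Matrix (Fin n) (Fin n) ℝ)
    (hP : ∀ i, (P i).PosDef)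
    (hRic : ∀ i, P i * A i + (A i)ᵀ * P i - P i * B i * (B i)ᵀ * P i = -1)
    (K : (i : Fin N) → Matrix (Fin (m i)) (Fin n) ℝ)
    (hK : ∀ i, K i = -((B i)ᵀ * P i))
    (a : ((i : Fin N) × Fin (l i)) → ((i : Fin N) × Fin (l i)) → ℝ)
    (ha : ∀ v, a v v = 0)
    (b : ((i : Fin N) × Fin (l i)) → ((i : Fin N) × Fin (l i)) → ℝ)
    (hb : ∀ v w, b v w = if v = w then ∑ u, a v u else -(a v w))
    (hrow : ∀ (i j : Fin N) (p : Fin (l i)), ∑ q : Fin (l j), b ⟨i, p⟩ ⟨j, q⟩ = 0)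
    (c : ℝ) (hc : 0 < c) (ci : Fin N → ℝ) (hci : ∀ i, 0 < ci i)
    -- each subgraph has only cooperative edges
    (hcoop : ∀ (i : Fin N) (p q : Fin (l i)), 0 ≤ a ⟨i, p⟩ ⟨i, q⟩)
    -- each subgraph contains a directed spanning tree
    (htree : ∀ i : Fin N, ∃ r : Fin (l i), ∀ p : Fin (l i),
      Relation.ReflTransGen (fun k j : Fin (l i) => 0 < a ⟨i, j⟩ ⟨i, k⟩) r p)
    -- the global weighting factor bound (11)
    (hcglob : ∀ i : Fin N, maxEig (A i + (A i)ᵀ) < c)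
    -- the local weighting factor bounds (12)
    (What : Matrix ((i : Fin N) × Fin (l i - 1)) ((i : Fin N) × Fin (l i - 1)) ℝ)
    (hWblock : ∀ p q : (i : Fin N) × Fin (l i - 1), p.1 ≠ q.1 → What p q = 0)
    (hWpd : ∀ i : Fin N, (diagBlock What i).PosDef)
    (hWLpd : ∀ i : Fin N,
      (diagBlock What i * diagBlock (reducedLap N l b) i +
        (diagBlock (reducedLap N l b) i)ᵀ * diagBlock What i).PosDef)
    (hcloc : ∀ i : Fin N,
      (maxEig What -
          minEig (What * reducedLapOff N l b + (reducedLapOff N l b)ᵀ * What)) /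
        minEig (diagBlock What i * diagBlock (reducedLap N l b) i +
          (diagBlock (reducedLap N l b) i)ᵀ * diagBlock What i) ≤ ci i) :
    IsHurwitz (clusterMatrix n N l c ci A b)
    ∧ (∀ ζ : ℝ → ((((i : Fin N) × Fin (l i - 1)) × Fin n) → ℝ),
        (∀ t : ℝ, HasDerivAt ζ ((clusterMatrix n N l c ci A b).mulVec (ζ t)) t) →
        ∃ C : ℝ, ∀ t : ℝ, 0 ≤ t →
          ‖ζ t‖ ≤ C * Real.exp
            (-((c - maxEig (hatA n N l A + (hatA n N l A)ᵀ)) / 2) * t))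
    ∧ (∀ x η : ((i : Fin N) × Fin (l i)) → ℝ → (Fin n → ℝ),
        (∀ (i : Fin N) (p : Fin (l i)) (t : ℝ),
          HasDerivAt (x ⟨i, p⟩)
            ((A i).mulVec (x ⟨i, p⟩ t) + (B i * K i).mulVec (η ⟨i, p⟩ t)) t) →
        (∀ (i : Fin N) (p : Fin (l i)) (t : ℝ),
          HasDerivAt (η ⟨i, p⟩)
            ((A i + B i * K i).mulVec (η ⟨i, p⟩ t) +
              c • (ci i •
                  ∑ k : Fin (l i), a ⟨i, p⟩ ⟨i, k⟩ •
                    (η ⟨i, k⟩ t - η ⟨i, p⟩ t + x ⟨i, p⟩ t - x ⟨i, k⟩ t) +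
                ∑ w : (j : Fin N) × Fin (l j),
                  if w.1 = i then 0 else a ⟨i, p⟩ w •
                    (η w t - η ⟨i, p⟩ t + x ⟨i, p⟩ t - x w t))) t) →
        ((∀ (i : Fin N) (p q : Fin (l i)),
            Tendsto (fun t => x ⟨i, p⟩ t - x ⟨i, q⟩ t) atTop (nhds 0))
          ∧ (∀ v : (i : Fin N) × Fin (l i), Tendsto (η v) atTop (nhds 0)))) := by
  have hWeq := eq_blockDiagonal'_diagBlock hWblock
  have hW : What.PosDef := hWeq ▸ posDef_blockDiagonal' hWpd
  have hWL := posSemidef_lyapunov_reducedLapWeighted hci hWblock hW.1 hWLpd hcloc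
  have hlyap := clusterMatrix_lyapunov (n := n) (A := A) hc hWblock hW hWL
  have hWkron := hW.kronecker (PosDef.one (n := Fin n) (R := ℝ))
  have hdecay := fun ζ => exists_norm_le_mul_exp_of_lyapunov (ζ := ζ) hWkron hlyap
  rcases isEmpty_or_nonempty (((i : Fin N) × Fin (l i - 1)) × Fin n) with hempty | hne
  · refine ⟨fun μ hμ => ?_, hdecay, fun x η hx hη => closedLoop_tendsto hl hP hRic hK
      (fun v w hvw => by simp [hb, hvw]) hrow (fun ζ _ => ?_) hx hη⟩
    · rw [spectrum.of_subsingleton] at hμ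
      exact hμ.elim
    · rw [Subsingleton.elim ζ fun _ => 0]
      exact tendsto_const_nhds
  · have hrate := sub_pos.2 (maxEig_hatA_lt (l := l) hcglob)
    refine ⟨isHurwitz_of_lyapunov hWkron hrate hlyap, hdecay, fun x η hx hη =>
      closedLoop_tendsto hl hP hRic hK (fun v w hvw => by simp [hb, hvw]) hrow
        (fun ζ hζ => ?_) hx hη⟩
    obtain ⟨C, hC⟩ := hdecay ζ hζ
    refine squeeze_zero_norm' ((eventually_ge_atTop 0).mono hC) ?_
    have hexp := Real.tendsto_exp_atBot.comp
      (tendsto_id.const_mul_atTop_of_neg (neg_lt_zero.2 (half_pos hrate)))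
    simpa [Function.comp_def] using hexp.const_mul C
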